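/- (Main theorem, expected degree, second case.) For all N ≥ 1, the expected degree satisfies E_{μ_{N,1}}[a] = ( 2(N−1)n(n+2) + (N−1)(N−2)(m+n)(m+n+2) ) / ( 12(m+n+1) ) + ⌊N/2⌋·(m+n)/2. -/

import Mathlib

open Finsupp Filter

noncomputable section

/-- Signed-sum convention: `signedSum c k = Σ_{i=0}^{k} c i`, which is the ordinary sum for
`k ≥ 0`, is `0` for `k = -1`, and equals `-(c (-1) + c (-2) + ⋯ + c (k+1))` for `k ≤ -2`. -/
def signedSum {M : Type*} [AddCommGroup M] (c : ℤ → M) (k : ℤ) : M :=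
  (∑ i ∈ Finset.range (k + 1).toNat, c i) -
    ∑ i ∈ Finset.range (-(k + 1)).toNat, c (-((i : ℤ) + 1))

/-- The Demazure operator `D₀` (relative to `Λ = mΛ₀ + nΛ₁`):
`D₀ δ_{(a,b)} = Σ_{i=0}^{m - 2(a-b)} δ_{(a+i,b)}`, extended ℤ-linearly. -/
def D0 (m : ℕ) (μ : ℤ × ℤ →₀ ℤ) : ℤ × ℤ →₀ ℤ :=
  μ.sum fun p c =>
    c • signedSum (fun i => Finsupp.single (p.1 + i, p.2) (1 : ℤ)) ((m : ℤ) - 2 * (p.1 - p.2))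

/-- The Demazure operator `D₁` (relative to `Λ = mΛ₀ + nΛ₁`):
`D₁ δ_{(a,b)} = Σ_{i=0}^{n + 2(a-b)} δ_{(a,b+i)}`, extended ℤ-linearly. -/
def D1 (n : ℕ) (μ : ℤ × ℤ →₀ ℤ) : ℤ × ℤ →₀ ℤ :=
  μ.sum fun p c =>
    c • signedSum (fun i => Finsupp.single (p.1, p.2 + i) (1 : ℤ)) ((n : ℤ) + 2 * (p.1 - p.2))

/-- Total mass `μ(Γ)` of a finitely supported function on `ℤ × ℤ`. -/
def mass (μ : ℤ × ℤ →₀ ℤ) : ℤ := μ.sum fun _ c => c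

/-- Expected value `E_ν[f] = (1/ν(Γ)) Σ ν(a,b) f(a,b)`. -/
def expVal (ν : ℤ × ℤ →₀ ℤ) (f : ℤ × ℤ → ℚ) : ℚ :=
  (mass ν : ℚ)⁻¹ * ν.sum fun p c => (c : ℚ) * f p

/-- Covariance `Cov_ν(f,g) = E_ν[f·g] - E_ν[f]·E_ν[g]`. -/
def cov (ν : ℤ × ℤ →₀ ℤ) (f g : ℤ × ℤ → ℚ) : ℚ :=
  expVal ν (fun p => f p * g p) - expVal ν f * expVal ν g

/-- Variance `Var_ν(f) = Cov_ν(f,f)`. -/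
def var (ν : ℤ × ℤ →₀ ℤ) (f : ℤ × ℤ → ℚ) : ℚ := cov ν f f

/-- The coordinate function `a` (the degree). -/
def fa : ℤ × ℤ → ℚ := fun p => (p.1 : ℚ)

/-- The coordinate function `b`. -/
def fb : ℤ × ℤ → ℚ := fun p => (p.2 : ℚ)

/-- The finite-weight coordinate `a - b`. -/
def fab : ℤ × ℤ → ℚ := fun p => (p.1 : ℚ) - (p.2 : ℚ)

/-- `μ_{N,0}`: start from `δ_{(0,0)}`, apply `D₀` at odd steps and `D₁` at even steps. -/
def mu0 (m n : ℕ) : ℕ → (ℤ × ℤ →₀ ℤ)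
  | 0 => Finsupp.single (0, 0) 1
  | N + 1 => if N % 2 = 0 then D0 m (mu0 m n N) else D1 n (mu0 m n N)

/-- `μ_{N,1}`: start from `δ_{(0,0)}`, apply `D₁` at odd steps and `D₀` at even steps. -/
def mu1 (m n : ℕ) : ℕ → (ℤ × ℤ →₀ ℤ)
  | 0 => Finsupp.single (0, 0) 1
  | N + 1 => if N % 2 = 0 then D1 n (mu1 m n N) else D0 m (mu1 m n N)

/-- Telescoping for the signed-sum convention. -/
theorem signedSum_eq_sub {M : Type*} [AddCommGroup M] (c G : ℤ → M)
    (h : ∀ i, G (i + 1) - G i = c i) (k : ℤ) : signedSum c k = G (k + 1) - G 0 := by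
  have hpos (r : ℕ) : ∑ i ∈ Finset.range r, c i = G r - G 0 := by
    simp_rw [← h]
    exact_mod_cast Finset.sum_range_sub (fun i : ℕ => G i) r
  have hneg (r : ℕ) : ∑ i ∈ Finset.range r, c (-((i : ℤ) + 1)) = G 0 - G (-r) := by
    induction r with
    | zero => simp
    | succ r ih =>
      rw [Finset.sum_range_succ, ih, ← h, neg_add_rev, neg_add_cancel_comm]
      push_cast
      rw [neg_add_rev]
      abel
  rw [signedSum, hpos, hneg]
  obtain hk | hk := le_total 0 (k + 1)
  · rw [Int.toNat_of_nonneg hk, Int.toNat_of_nonpos (by omega)]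
    simp
  · rw [Int.toNat_of_nonpos hk, Int.toNat_of_nonneg (by omega)]
    simp

theorem map_signedSum {M M' F : Type*} [AddCommGroup M] [AddCommGroup M'] [FunLike F M M']
    [AddMonoidHomClass F M M'] (φ : F) (c : ℤ → M) (k : ℤ) :
    φ (signedSum c k) = signedSum (fun i => φ (c i)) k := by
  simp [signedSum]

/-- The unnormalised expectation `Σ ν(a,b) f(a,b)`. -/
def integral (ν : ℤ × ℤ →₀ ℤ) (f : ℤ × ℤ → ℚ) : ℚ := Finsupp.linearCombination ℤ f ν

theorem expVal_eq_integral (ν : ℤ × ℤ →₀ ℤ) (f : ℤ × ℤ → ℚ) :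
    expVal ν f = (integral ν fun _ => 1)⁻¹ * integral ν f := by
  simp [expVal, mass, integral, Finsupp.linearCombination_apply, Finsupp.sum]

theorem integral_D0 (m : ℕ) (ν : ℤ × ℤ →₀ ℤ) (f : ℤ × ℤ → ℚ) :
    integral (D0 m ν) f =
      integral ν fun p => signedSum (fun i => f (p.1 + i, p.2)) (m - 2 * (p.1 - p.2)) := by
  simp only [integral, D0, map_finsuppSum, map_zsmul, map_signedSum,
    Finsupp.linearCombination_single, one_smul]
  rw [Finsupp.linearCombination_apply]

theorem integral_D1 (n : ℕ) (ν : ℤ × ℤ →₀ ℤ) (f : ℤ × ℤ → ℚ) :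
    integral (D1 n ν) f =
      integral ν fun p => signedSum (fun i => f (p.1, p.2 + i)) (n + 2 * (p.1 - p.2)) := by
  simp only [integral, D1, map_finsuppSum, map_zsmul, map_signedSum,
    Finsupp.linearCombination_single, one_smul]
  rw [Finsupp.linearCombination_apply]

/-- The low-order moments of `ν` in the degree `a` and the centred weight `y = a - b - s`, for `ν`
whose first and third moments in `y` vanish: `M`, `A`, `V` and `K` are the integrals of
`1`, `a`, `y ^ 2` and `a * y`. -/
structure HasMoments (ν : ℤ × ℤ →₀ ℤ) (s M A V K : ℚ) : Prop where
  one : integral ν (fun _ => 1) = M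
  deg : integral ν (fun p => p.1) = A
  weight : integral ν (fun p => p.1 - p.2 - s) = 0
  weight_sq : integral ν (fun p => (p.1 - p.2 - s) ^ 2) = V
  weight_cube : integral ν (fun p => (p.1 - p.2 - s) ^ 3) = 0
  deg_mul_weight : integral ν (fun p => p.1 * (p.1 - p.2 - s)) = K

namespace HasMoments

variable {ν : ℤ × ℤ →₀ ℤ} {s M A V K : ℚ}

theorem integral_eq (h : HasMoments ν s M A V K) {f : ℤ × ℤ → ℚ} (c₀ c₁ c₂ c₃ c₄ c₅ : ℚ)
    (hf : ∀ a b : ℤ, f (a, b) = c₀ + c₁ * a + c₂ * (a - b - s) + c₃ * (a - b - s) ^ 2 +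
      c₄ * (a - b - s) ^ 3 + c₅ * (a * (a - b - s))) :
    integral ν f = c₀ * M + c₁ * A + c₃ * V + c₅ * K := by
  have key : integral ν f = c₀ * integral ν (fun _ => 1) + c₁ * integral ν (fun p => p.1) +
      c₂ * integral ν (fun p => p.1 - p.2 - s) + c₃ * integral ν (fun p => (p.1 - p.2 - s) ^ 2) +
      c₄ * integral ν (fun p => (p.1 - p.2 - s) ^ 3) +
      c₅ * integral ν (fun p => p.1 * (p.1 - p.2 - s)) := by
    simp only [integral, Finsupp.linearCombination_apply, Finsupp.sum, Finset.mul_sum,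
      ← Finset.sum_add_distrib, zsmul_eq_mul]
    refine Finset.sum_congr rfl fun p _ => ?_
    rw [hf p.1 p.2]
    ring
  rw [key, h.one, h.deg, h.weight, h.weight_sq, h.weight_cube, h.deg_mul_weight]
  ring

theorem D0 (h : HasMoments ν s M A V K) (m : ℕ) {L : ℚ} (hL : L = m - 2 * s + 1) :
    HasMoments (D0 m ν) (m / 2) (L * M) (L * A + L * (L - 1) / 2 * M + 2 * V - 2 * K)
      (L * V + L * (L ^ 2 - 1) / 12 * M) (L * V + L * (L ^ 2 - 1) / 12 * M) := by
  obtain rfl : s = (m + 1 - L) / 2 := by linarith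
  constructor <;> rw [integral_D0]
  · rw [h.integral_eq L 0 (-2) 0 0 0]
    · ring
    · intro a b
      rw [signedSum_eq_sub _ (fun i => (i : ℚ)) (by intro i; push_cast; ring)]
      push_cast
      ring
  · rw [h.integral_eq (L * (L - 1) / 2) L (-(2 * L - 1)) 2 0 (-2)]
    · ring
    · intro a b
      rw [signedSum_eq_sub _ (fun i => (a * i + i * (i - 1) / 2 : ℚ)) (by intro i; push_cast; ring)]
      push_cast
      ring
  · rw [h.integral_eq 0 0 0 0 0 0]
    · ring
    · intro a b
      rw [signedSum_eq_sub _ (fun i =>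
        let t : ℚ := a + i - b - m / 2;
        t * (t - 1) / 2) (by intro i; push_cast; ring)]
      push_cast
      ring
  · rw [h.integral_eq (L * (L ^ 2 - 1) / 12) 0 (-(3 * L ^ 2 - 1) / 6) L (-2 / 3) 0]
    · ring
    · intro a b
      rw [signedSum_eq_sub _ (fun i =>
        let t : ℚ := a + i - b - m / 2;
        t * (t - 1) * (2 * t - 1) / 6) (by intro i; push_cast; ring)]
      push_cast
      ring
  · rw [h.integral_eq 0 0 0 0 0 0]
    · ring
    · intro a b
      rw [signedSum_eq_sub _ (fun i =>
        let t : ℚ := a + i - b - m / 2;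
        (t * (t - 1) / 2) ^ 2) (by intro i; push_cast; ring)]
      push_cast
      ring
  · rw [h.integral_eq (L * (L ^ 2 - 1) / 12) 0 (-(3 * L ^ 2 - 1) / 6) L (-2 / 3) 0]
    · ring
    · intro a b
      rw [signedSum_eq_sub _ (fun i =>
        let t : ℚ := a + i - b - m / 2;
        t * (t - 1) * (2 * t - 1) / 6 + (b + m / 2) * (t * (t - 1) / 2))
          (by intro i; push_cast; ring)]
      push_cast
      ring

theorem D1 (h : HasMoments ν s M A V K) (n : ℕ) {L : ℚ} (hL : L = n + 2 * s + 1) :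
    HasMoments (D1 n ν) (-n / 2) (L * M) (L * A + 2 * K)
      (L * V + L * (L ^ 2 - 1) / 12 * M) 0 := by
  obtain rfl : s = (L - n - 1) / 2 := by linarith
  constructor <;> rw [integral_D1]
  · rw [h.integral_eq L 0 2 0 0 0]
    · ring
    · intro a b
      rw [signedSum_eq_sub _ (fun i => (i : ℚ)) (by intro i; push_cast; ring)]
      push_cast
      ring
  · rw [h.integral_eq 0 L 0 0 0 2]
    · ring
    · intro a b
      rw [signedSum_eq_sub _ (fun i => (a * i : ℚ)) (by intro i; push_cast; ring)]
      push_cast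
      ring
  · rw [h.integral_eq 0 0 0 0 0 0]
    · ring
    · intro a b
      rw [signedSum_eq_sub _ (fun i =>
        let t : ℚ := b + i - a - n / 2;
        -(t * (t - 1) / 2)) (by intro i; push_cast; ring)]
      push_cast
      ring
  · rw [h.integral_eq (L * (L ^ 2 - 1) / 12) 0 ((3 * L ^ 2 - 1) / 6) L (2 / 3) 0]
    · ring
    · intro a b
      rw [signedSum_eq_sub _ (fun i =>
        let t : ℚ := b + i - a - n / 2;
        t * (t - 1) * (2 * t - 1) / 6) (by intro i; push_cast; ring)]
      push_cast
      ring
  · rw [h.integral_eq 0 0 0 0 0 0]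
    · ring
    · intro a b
      rw [signedSum_eq_sub _ (fun i =>
        let t : ℚ := b + i - a - n / 2;
        -(t * (t - 1) / 2) ^ 2) (by intro i; push_cast; ring)]
      push_cast
      ring
  · rw [h.integral_eq 0 0 0 0 0 0]
    · ring
    · intro a b
      rw [signedSum_eq_sub _ (fun i =>
        let t : ℚ := b + i - a - n / 2;
        -a * (t * (t - 1) / 2)) (by intro i; push_cast; ring)]
      push_cast
      ring

end HasMoments

theorem hasMoments_single_zero : HasMoments (Finsupp.single (0, 0) 1) 0 1 0 0 0 := by
  constructor <;> simp [integral]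

theorem hasMoments_mu1_even_of_odd (m n k : ℕ)
    (h : ∃ M ≠ 0, HasMoments (mu1 m n (2 * k + 1)) (-n / 2) M
      (((2 * (2 * k) * n * (n + 2) + 2 * k * (2 * k - 1) * (m + n) * (m + n + 2)) /
          (12 * (m + n + 1)) + k * (m + n) / 2) * M)
      ((n * (n + 2) + 2 * k * (m + n) * (m + n + 2)) / 12 * M) 0) :
    ∃ M ≠ 0, HasMoments (mu1 m n (2 * k + 2)) (m / 2) M
      (((2 * (2 * k + 1) * n * (n + 2) + (2 * k + 1) * (2 * k) * (m + n) * (m + n + 2)) /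
          (12 * (m + n + 1)) + (k + 1) * (m + n) / 2) * M)
      ((n * (n + 2) + (2 * k + 1) * (m + n) * (m + n + 2)) / 12 * M)
      ((n * (n + 2) + (2 * k + 1) * (m + n) * (m + n + 2)) / 12 * M) := by
  obtain ⟨M, hM, h⟩ := h
  have hL : (m + n + 1 : ℚ) ≠ 0 := by positivity
  refine ⟨(m + n + 1) * M, mul_ne_zero hL hM, ?_⟩
  rw [show mu1 m n (2 * k + 2) = D0 m (mu1 m n (2 * k + 1)) by simp [mu1, Nat.add_mod]]
  convert h.D0 m (L := m + n + 1) (by ring) using 1 <;> field_simp <;> ring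

theorem hasMoments_mu1_odd (m n k : ℕ) : ∃ M ≠ 0, HasMoments (mu1 m n (2 * k + 1)) (-n / 2) M
      (((2 * (2 * k) * n * (n + 2) + 2 * k * (2 * k - 1) * (m + n) * (m + n + 2)) /
          (12 * (m + n + 1)) + k * (m + n) / 2) * M)
      ((n * (n + 2) + 2 * k * (m + n) * (m + n + 2)) / 12 * M) 0 := by
  induction k with
  | zero =>
    refine ⟨n + 1, by positivity, ?_⟩
    rw [show mu1 m n (2 * 0 + 1) = D1 n (Finsupp.single (0, 0) 1) by simp [mu1]]
    convert hasMoments_single_zero.D1 n (L := n + 1) (by ring) using 1 <;> push_cast <;> ring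
  | succ k ih =>
    obtain ⟨M, hM, h⟩ := hasMoments_mu1_even_of_odd m n k ih
    have hL : (m + n + 1 : ℚ) ≠ 0 := by positivity
    refine ⟨(m + n + 1) * M, mul_ne_zero hL hM, ?_⟩
    rw [show mu1 m n (2 * (k + 1) + 1) = D1 n (mu1 m n (2 * k + 2)) by
      simp [mu1, mul_add, Nat.add_mod]]
    convert h.D1 n (L := m + n + 1) (by ring) using 1 <;> push_cast <;> field_simp <;> ring

/-- main theorem, expected degree, second case. -/
theorem stmt_16 (m n : ℕ) (N : ℕ) (hN : 1 ≤ N) :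
    expVal (mu1 m n N) fa =
      (2 * ((N : ℚ) - 1) * (n : ℚ) * ((n : ℚ) + 2) +
        ((N : ℚ) - 1) * ((N : ℚ) - 2) * ((m : ℚ) + (n : ℚ)) * ((m : ℚ) + (n : ℚ) + 2)) /
        (12 * ((m : ℚ) + (n : ℚ) + 1)) +
      ((N / 2 : ℕ) : ℚ) * ((m : ℚ) + (n : ℚ)) / 2 := by
  have hE {N : ℕ} {s M E V K : ℚ} (hM : M ≠ 0) (h : HasMoments (mu1 m n N) s M (E * M) V K) :
      expVal (mu1 m n N) fa = E := by
    rw [expVal_eq_integral, h.one]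
    change M⁻¹ * integral (mu1 m n N) (fun p => p.1) = E
    rw [h.deg, mul_comm, mul_inv_cancel_right₀ hM]
  obtain ⟨k, rfl | rfl⟩ : ∃ k, N = 2 * k + 1 ∨ N = 2 * k + 2 := ⟨(N - 1) / 2, by omega⟩
  · obtain ⟨M, hM, h⟩ := hasMoments_mu1_odd m n k
    rw [hE hM h, show (2 * k + 1) / 2 = k by omega]
    push_cast
    ring
  · obtain ⟨M, hM, h⟩ := hasMoments_mu1_even_of_odd m n k (hasMoments_mu1_odd m n k)
    rw [hE hM h, show (2 * k + 2) / 2 = k + 1 by omega]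
    push_cast
    ring
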